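/- Let p be an odd prime such that 2 is a primitive root modulo p, let a be an integer with gcd(a, p) = 1, and let n ≥ 1. If every positive integer m with m ≡ a (mod p^n) has some iterate T^(k)(m) = 1, then every positive integer has some iterate under T equal to 1. -/

import Mathlib

/-- The 3x+1 function `T : ℤ → ℤ`. -/
def collatzT (x : ℤ) : ℤ := if x % 2 = 1 then (3 * x + 1) / 2 else x / 2

/-- Some iterate of `x` under the 3x+1 function is `1`. -/
def ReachesOne (x : ℤ) : Prop := ∃ k : ℕ, collatzT^[k] x = 1

lemma collatzT_two_mul (x : ℤ) : collatzT (2 * x) = x := by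
  unfold collatzT
  split_ifs <;> omega

lemma collatzT_two_mul_sub_one (x : ℤ) : collatzT (2 * x - 1) = 3 * x - 1 := by
  unfold collatzT
  split_ifs <;> omega

lemma reachesOne_collatzT_iff (x : ℤ) : ReachesOne (collatzT x) ↔ ReachesOne x := by
  constructor
  · rintro ⟨k, hk⟩
    exact ⟨k + 1, by rwa [Function.iterate_succ_apply]⟩
  · rintro ⟨k, hk⟩
    cases k with
    | zero =>
      obtain rfl : x = 1 := hk
      exact ⟨1, by decide⟩
    | succ k => exact ⟨k, by rwa [Function.iterate_succ_apply] at hk⟩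

lemma reachesOne_two_pow_mul_iff (M : ℕ) (x : ℤ) : ReachesOne (2 ^ M * x) ↔ ReachesOne x := by
  induction M with
  | zero => simp
  | succ M ih =>
    rw [← ih, ← reachesOne_collatzT_iff, pow_succ', mul_assoc, collatzT_two_mul]

lemma reachesOne_two_pow_mul_sub_one_iff (j : ℕ) (u : ℤ) :
    ReachesOne (2 ^ j * u - 1) ↔ ReachesOne (3 ^ j * u - 1) := by
  induction j generalizing u with
  | zero => simp
  | succ j ih =>
    rw [← reachesOne_collatzT_iff, pow_succ', mul_assoc, collatzT_two_mul_sub_one,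
      show 3 * (2 ^ j * u) - 1 = 2 ^ j * (3 * u) - 1 by ring, ih,
      show (3 : ℤ) ^ j * (3 * u) = 3 ^ (j + 1) * u by ring]

/-- The trajectory of a positive integer meets a positive integer not divisible by `3`. -/
lemma exists_not_three_dvd_reachesOne_iff (m : ℕ) (hm : 0 < m) :
    ∃ x : ℤ, 0 < x ∧ ¬ 3 ∣ x ∧ (ReachesOne x ↔ ReachesOne m) := by
  induction m using Nat.strong_induction_on with
  | _ m ih =>
    obtain ⟨w, rfl | rfl⟩ := Nat.even_or_odd' m
    · obtain ⟨x, hx, hx3, hiff⟩ := ih w (by omega) (by omega)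
      refine ⟨x, hx, hx3, hiff.trans ?_⟩
      rw [← reachesOne_collatzT_iff ((2 * w : ℕ) : ℤ)]
      push_cast
      rw [collatzT_two_mul]
    · refine ⟨3 * (w + 1) - 1, by omega, by omega, ?_⟩
      rw [← collatzT_two_mul_sub_one, reachesOne_collatzT_iff,
        show (2 : ℤ) * (w + 1) - 1 = ((2 * w + 1 : ℕ) : ℤ) by push_cast; ring]

lemma orderOf_two_zmod_three_pow (N : ℕ) : orderOf (2 : ZMod (3 ^ (N + 1))) = 2 * 3 ^ N := by
  have h4 : orderOf (4 : ZMod (3 ^ (N + 1))) = 3 ^ N := by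
    have := ZMod.orderOf_one_add_mul_prime (p := 3) Nat.prime_three (by decide) 1 (by decide) N
    rw [← this]
    norm_num
  have heven : 2 ∣ orderOf (2 : ZMod (3 ^ (N + 1))) := by
    have h3 : orderOf (2 : ZMod 3) = 2 := orderOf_eq_prime (by decide) (by decide)
    have := orderOf_map_dvd
      (ZMod.castHom (dvd_pow_self 3 N.succ_ne_zero) (ZMod 3) : ZMod (3 ^ (N + 1)) →* ZMod 3) 2
    rwa [MonoidHom.coe_coe, map_ofNat, h3] at this
  have hpow := orderOf_pow_of_dvd two_ne_zero heven
  rw [show (2 : ZMod (3 ^ (N + 1))) ^ 2 = 4 by norm_num, h4] at hpow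
  omega

lemma isUnit_two_zmod_three_pow (N : ℕ) : IsUnit (2 : ZMod (3 ^ N)) := by
  simpa using (ZMod.isUnit_iff_coprime 2 (3 ^ N)).2 (Nat.Coprime.pow_right _ (by decide))

lemma two_pow_modEq_two_pow_iff (N A B : ℕ) :
    (2 : ℤ) ^ A ≡ 2 ^ B [ZMOD 3 ^ (N + 1)] ↔ A ≡ B [MOD 2 * 3 ^ N] := by
  obtain ⟨u, hu⟩ := isUnit_two_zmod_three_pow (N + 1)
  have h := ZMod.intCast_eq_intCast_iff (2 ^ A) (2 ^ B) (3 ^ (N + 1))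
  push_cast at h
  rw [← h, ← orderOf_two_zmod_three_pow, ← hu, orderOf_units, ← pow_eq_pow_iff_modEq,
    ← Units.val_inj]
  push_cast
  rfl

/-- `2` generates the units modulo a power of `3`. -/
lemma exists_two_pow_modEq (N : ℕ) (b : ℤ) (hb : ¬ 3 ∣ b) :
    ∃ M : ℕ, (2 : ℤ) ^ M ≡ b [ZMOD 3 ^ (N + 1)] := by
  have hbu : IsUnit (b : ZMod (3 ^ (N + 1))) := by
    rw [ZMod.coe_int_isUnit_iff_isCoprime]
    push_cast
    exact ((Int.prime_three.coprime_iff_not_dvd).2 hb).pow_left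
  obtain ⟨u, hu⟩ := isUnit_two_zmod_three_pow (N + 1)
  obtain ⟨v, hv⟩ := hbu
  have hord : orderOf u = Nat.card (ZMod (3 ^ (N + 1)))ˣ := by
    rw [← orderOf_units, hu, orderOf_two_zmod_three_pow, Nat.card_eq_fintype_card,
      ZMod.card_units_eq_totient, Nat.totient_prime_pow_succ Nat.prime_three]
    ring
  have htop : v ∈ Submonoid.powers u := mem_powers_iff_mem_zpowers.2 <| by
    rw [Subgroup.eq_top_of_card_eq (Subgroup.zpowers u) (by rw [Nat.card_zpowers, hord])]
    trivial
  obtain ⟨M, hM⟩ := htop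
  refine ⟨M, ?_⟩
  have : ((2 ^ M : ℤ) : ZMod (3 ^ (N + 1))) = (b : ℤ) := by
    rw [← hv, ← hM]
    push_cast
    rw [hu]
  simpa using (ZMod.intCast_eq_intCast_iff _ _ _).1 this

lemma exists_two_pow_mul_modEq (N : ℕ) (m b : ℤ) (hm : ¬ 3 ∣ m) (hb : ¬ 3 ∣ b) :
    ∃ M : ℕ, 2 ^ M * m ≡ b [ZMOD 3 ^ (N + 1)] := by
  obtain ⟨A, hA⟩ := exists_two_pow_modEq N m hm
  have hord : (2 : ℤ) ^ (2 * 3 ^ N) ≡ 1 [ZMOD 3 ^ (N + 1)] := by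
    simpa using (two_pow_modEq_two_pow_iff N (2 * 3 ^ N) 0).2 (by simp [Nat.ModEq])
  obtain ⟨B, hB⟩ := exists_two_pow_modEq N b hb
  refine ⟨(2 * 3 ^ N - 1) * A + B, ?_⟩
  have hpos : 0 < 3 ^ N := by positivity
  calc 2 ^ ((2 * 3 ^ N - 1) * A + B) * m
      ≡ 2 ^ ((2 * 3 ^ N - 1) * A + B) * 2 ^ A [ZMOD 3 ^ (N + 1)] := (hA.symm).mul_left _
    _ = (2 ^ (2 * 3 ^ N)) ^ A * 2 ^ B := by
        obtain ⟨d, hd⟩ : ∃ d, 2 * 3 ^ N = d + 1 := ⟨2 * 3 ^ N - 1, by omega⟩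
        rw [hd, Nat.add_sub_cancel]
        ring
    _ ≡ 1 ^ A * b [ZMOD 3 ^ (N + 1)] := (hord.pow A).mul hB
    _ = b := by ring

lemma exists_two_pow_mul_modEq_three_pow (k J : ℕ) (b : ℤ) :
    ∃ c : ℤ, 2 ^ k * c ≡ b [ZMOD 3 ^ J] := by
  obtain ⟨x, y, hxy⟩ : IsCoprime ((2 : ℤ) ^ k) (3 ^ J) := IsCoprime.pow (by norm_num)
  exact ⟨x * b, (Int.modEq_iff_dvd).2 ⟨y * b, by linear_combination -b * hxy⟩⟩

/-- From `m` one reaches backwards a fixed residue class modulo `q` intersected with any residue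
class modulo any power of `3`. -/
lemma exists_residue_forall_three_pow (q : ℕ) (hq : 0 < q) (hq2 : q.Coprime 2)
    (hq3 : q.Coprime 3) (m : ℤ) (hm : 0 < m) (hm3 : ¬ 3 ∣ m) :
    ∃ r : ZMod q, ∀ (J : ℕ) (s : ℤ), ∃ y : ℤ, 0 < y ∧ (y : ZMod q) = r ∧
      y ≡ s [ZMOD 3 ^ J] ∧ (ReachesOne y ↔ ReachesOne m) := by
  obtain ⟨v, w, hw, hvw⟩ := Nat.exists_eq_pow_mul_and_not_dvd
    (Nat.totient_pos.2 hq).ne' 3 (by decide)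
  obtain ⟨A, hA⟩ := exists_two_pow_mul_modEq v m (-1) hm3 (by decide)
  have hinv : IsUnit ((3 : ZMod q) ^ (v + 1)) := by
    have := (ZMod.isUnit_iff_coprime 3 q).2 hq3.symm
    exact IsUnit.pow _ (by simpa using this)
  obtain ⟨u₀, hu₀⟩ := hA.symm.dvd
  refine ⟨2 ^ (v + 1) * u₀ - 1, fun J s => ?_⟩
  obtain ⟨c, hc⟩ := exists_two_pow_mul_modEq_three_pow (v + 1) J (s + 1)
  obtain ⟨B, hB⟩ := exists_two_pow_mul_modEq (v + J) m (3 ^ (v + 1) * c - 1) hm3 (by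
    rw [pow_succ', mul_assoc]; omega)
  have hAB : A ≡ B [MOD 2 * 3 ^ v] := by
    rw [← two_pow_modEq_two_pow_iff]
    have hB' : 2 ^ B * m ≡ -1 [ZMOD 3 ^ (v + 1)] :=
      (hB.of_dvd (pow_dvd_pow 3 (by omega))).trans
        ((Int.modEq_iff_dvd).2 ⟨-c, by ring⟩)
    refine (Int.modEq_iff_dvd).2 (IsCoprime.dvd_of_dvd_mul_right (z := m) ?_ ?_)
    · exact ((Int.prime_three.coprime_iff_not_dvd).2 hm3).pow_left
    · rw [sub_mul]
      exact (hA.trans hB'.symm).dvd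
  obtain ⟨M, hMA, hMB⟩ : ∃ M : ℕ, M ≡ A [MOD 2 * q.totient] ∧ M ≡ B [MOD 2 * 3 ^ (v + J)] := by
    have hg : Nat.gcd (2 * q.totient) (2 * 3 ^ (v + J)) = 2 * 3 ^ v := by
      rw [hvw, pow_add, ← mul_assoc, ← mul_assoc, Nat.gcd_mul_left]
      have : Nat.gcd w (3 ^ J) = 1 :=
        (((Nat.prime_three.coprime_iff_not_dvd).2 hw).symm).pow_right J
      rw [this, mul_one]
    obtain ⟨M, hM⟩ := Nat.chineseRemainder' (hg.symm ▸ hAB)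
    exact ⟨M, hM⟩
  have hM3 : 2 ^ M * m ≡ 3 ^ (v + 1) * c - 1 [ZMOD 3 ^ (v + J + 1)] :=
    (((two_pow_modEq_two_pow_iff _ M B).2 hMB).mul_right m).trans hB
  have hMq : (2 : ZMod q) ^ M = 2 ^ A := by
    obtain ⟨t, ht⟩ : IsUnit (2 : ZMod q) := by
      simpa using (ZMod.isUnit_iff_coprime 2 q).2 hq2.symm
    have hdvd : orderOf t ∣ 2 * q.totient :=
      (orderOf_dvd_of_pow_eq_one (ZMod.pow_totient t)).mul_left 2
    rw [← ht, ← Units.val_pow_eq_pow_val, ← Units.val_pow_eq_pow_val,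
      pow_eq_pow_iff_modEq.2 (hMA.of_dvd hdvd)]
  obtain ⟨u, hu⟩ : (3 : ℤ) ^ (v + 1) ∣ 2 ^ M * m + 1 := by
    obtain ⟨d, hd⟩ := hM3.symm.dvd
    exact ⟨3 ^ J * d + c, by linear_combination hd⟩
  have hupos : 0 < u := by
    have : 0 < (3 : ℤ) ^ (v + 1) * u := by rw [← hu]; positivity
    exact pos_of_mul_pos_right this (by positivity)
  refine ⟨2 ^ (v + 1) * u - 1, ?_, ?_, ?_, ?_⟩
  · rw [pow_succ', mul_assoc]
    have : 0 < (2 : ℤ) ^ v * u := by positivity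
    omega
  · have huu : (u : ZMod q) = u₀ := by
      refine hinv.mul_right_injective ?_
      have h := congrArg (Int.cast : ℤ → ZMod q) hu
      have h₀ := congrArg (Int.cast : ℤ → ZMod q) hu₀
      push_cast at h h₀
      rw [hMq] at h
      linear_combination h₀ - h
    push_cast
    rw [huu]
  · have huc : u ≡ c [ZMOD 3 ^ J] := by
      refine (Int.modEq_iff_dvd).2 ?_
      have hd := hM3.dvd
      rw [show (3 : ℤ) ^ (v + 1) * c - 1 - 2 ^ M * m = 3 ^ (v + 1) * (c - u) by
          linear_combination -hu,
        show v + J + 1 = v + 1 + J by ring, pow_add] at hd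
      exact (mul_dvd_mul_iff_left (by positivity)).1 hd
    simpa using ((huc.mul_left (2 ^ (v + 1))).trans hc).sub_right 1
  · rw [reachesOne_two_pow_mul_sub_one_iff, ← hu, add_sub_cancel_right,
      reachesOne_two_pow_mul_iff]

lemma map_mem_of_preimage_subset {α : Type*} [Finite α] {f : α → α} (hf : f.Injective)
    {S : Set α} (hS : f ⁻¹' S ⊆ S) {x : α} (hx : x ∈ S) : f x ∈ S := by
  have hsub : S ⊆ f '' S := fun y hy => by
    obtain ⟨z, rfl⟩ := (Finite.surjective_of_injective hf) y
    exact ⟨z, hS hy, rfl⟩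
  have := Set.eq_of_subset_of_ncard_le hsub (Set.ncard_image_le (Set.toFinite S))
  rw [this]
  exact ⟨x, hx, rfl⟩

/-- A nonempty set of residues modulo `q`, with `q` prime to `6`, which is closed under
`2 * r ↦ r` and `(2 * r - 1) / 3 ↦ r` contains every residue. -/
lemma mem_of_backward_closed (q : ℕ) [NeZero q] (h2 : IsUnit (2 : ZMod q))
    (h3 : IsUnit (3 : ZMod q)) (S : Set (ZMod q)) (hne : S.Nonempty)
    (hdouble : ∀ r, 2 * r ∈ S → r ∈ S)
    (hodd : ∀ r r', 3 * r' = 2 * r - 1 → r' ∈ S → r ∈ S) (r : ZMod q) : r ∈ S := by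
  have hd : ∀ r, r ∈ S → 2 * r ∈ S := fun r hr =>
    map_mem_of_preimage_subset (f := fun r => 2 * r) h2.mul_right_injective hdouble hr
  have ht : ∀ r, r ∈ S → 3 * r + 1 ∈ S := fun r hr => by
    obtain ⟨t, ht⟩ := h2.dvd (a := 3 * r + 1)
    rw [ht]
    exact hd _ (hodd t r (by linear_combination ht) hr)
  have htinj : Function.Injective fun r : ZMod q => 3 * r + 1 := fun x y hxy =>
    h3.mul_right_injective (by simpa using hxy)
  have ht' : ∀ r, 3 * r + 1 ∈ S → r ∈ S := by
    have himage : (fun r : ZMod q => 3 * r + 1) '' S = S :=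
      Set.eq_of_subset_of_ncard_le (by rintro _ ⟨r, hr, rfl⟩; exact ht r hr)
        (Set.ncard_image_of_injective S htinj).ge
    intro r hr
    rw [← himage] at hr
    exact (htinj.mem_set_image).1 hr
  have hsucc : ∀ r, r ∈ S → r + 1 ∈ S := fun r hr => by
    obtain ⟨t, ht6⟩ := (h2.mul h3).dvd (a := r - 1)
    obtain rfl : r = 3 * (2 * t) + 1 := by linear_combination ht6
    have := hd _ (ht _ (hdouble _ (ht' _ hr)))
    convert this using 1
    ring
  obtain ⟨x, hx⟩ := hne
  have hadd : ∀ k : ℕ, x + k ∈ S := fun k => by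
    induction k with
    | zero => simpa using hx
    | succ k ih => simpa [add_assoc] using hsucc _ ih
  simpa using hadd (r - x).val

/-- Korec and Znam (1987): if `p` is an odd prime with `2` a primitive root mod `p`,
`gcd(a, p) = 1` and `n ≥ 1`, then verifying the 3x+1 Conjecture on the residue class
`a (mod p^n)` suffices to prove it for all positive integers. -/
theorem korec_znam (p : ℕ) (hp : p.Prime) (hodd : p ≠ 2)
    (hroot : orderOf (2 : ZMod p) = p - 1)
    (a : ℤ) (hgcd : Int.gcd a (p : ℤ) = 1) (n : ℕ) (hn : 1 ≤ n)
    (H : ∀ m : ℕ, 0 < m → (m : ℤ) ≡ a [ZMOD (p : ℤ) ^ n] →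
      ∃ k : ℕ, collatzT^[k] (m : ℤ) = 1) :
    ∀ m : ℕ, 0 < m → ∃ k : ℕ, collatzT^[k] (m : ℤ) = 1 := by
  intro m₀ hm₀
  obtain ⟨m, hm, hm3, hiff⟩ := exists_not_three_dvd_reachesOne_iff m₀ hm₀
  refine hiff.1 ?_
  have H' : ∀ y : ℤ, 0 < y → y ≡ a [ZMOD (p : ℤ) ^ n] → ReachesOne y := fun y hy hya => by
    lift y to ℕ using hy.le
    exact H y (by exact_mod_cast hy) hya
  obtain ⟨N, rfl⟩ : ∃ N, n = N + 1 := ⟨n - 1, by omega⟩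
  by_cases hp3 : p = 3
  · subst hp3
    have ha3 : ¬ 3 ∣ a := fun h => by
      have := Int.dvd_coe_gcd h (by simp : (3 : ℤ) ∣ ((3 : ℕ) : ℤ))
      rw [hgcd] at this
      omega
    obtain ⟨M, hM⟩ := exists_two_pow_mul_modEq N m a hm3 ha3
    exact (reachesOne_two_pow_mul_iff M m).1 (H' _ (by positivity) (by exact_mod_cast hM))
  have hq2 : (p ^ (N + 1)).Coprime 2 :=
    Nat.Coprime.pow_left _ ((Nat.coprime_primes hp Nat.prime_two).2 hodd)
  have hq3 : (p ^ (N + 1)).Coprime 3 :=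
    Nat.Coprime.pow_left _ ((Nat.coprime_primes hp Nat.prime_three).2 hp3)
  have hq : 0 < p ^ (N + 1) := pow_pos hp.pos _
  have hcast : ((p ^ (N + 1) : ℕ) : ℤ) = (p : ℤ) ^ (N + 1) := by push_cast; rfl
  rw [← hcast] at H'
  generalize p ^ (N + 1) = q at *
  have : NeZero q := ⟨hq.ne'⟩
  have h2 : IsUnit (2 : ZMod q) := by simpa using (ZMod.isUnit_iff_coprime 2 q).2 hq2.symm
  have h3 : IsUnit (3 : ZMod q) := by simpa using (ZMod.isUnit_iff_coprime 3 q).2 hq3.symm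
  have hhalf : ∀ (J : ℕ) (b : ℤ), ∃ s : ℤ, 2 * s ≡ b [ZMOD 3 ^ J] := fun J b => by
    simpa using exists_two_pow_mul_modEq_three_pow 1 J b
  obtain ⟨r, hr⟩ := exists_residue_forall_three_pow q hq hq2 hq3 m hm hm3
  obtain ⟨J, s, hJs⟩ := mem_of_backward_closed q h2 h3
    {r | ∃ (J : ℕ) (s : ℤ), ∀ y : ℤ, 0 < y → (y : ZMod q) = r → y ≡ s [ZMOD 3 ^ J] →
      ReachesOne y} ⟨a, 0, 0, fun y hy hya _ =>
        H' y hy ((ZMod.intCast_eq_intCast_iff _ _ _).1 hya)⟩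
    (by
      rintro r ⟨J, s, hs⟩
      obtain ⟨s', hs'⟩ := hhalf J s
      refine ⟨J, s', fun y hy hyr hys => ?_⟩
      rw [← collatzT_two_mul y, reachesOne_collatzT_iff]
      exact hs _ (by positivity) (by push_cast; rw [hyr]) ((hys.mul_left 2).trans hs'))
    (by
      rintro r r' hrr' ⟨J, s, hs⟩
      obtain ⟨s', hs'⟩ := hhalf (J + 1) (3 * s + 1)
      refine ⟨J + 1, s', fun y hy hyr hys => ?_⟩
      obtain ⟨d, hd⟩ := ((hys.mul_left 2).trans hs').symm.dvd
      have hz : 2 * y - 1 = 3 * (s + 3 ^ J * d) := by linear_combination hd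
      have hzy : collatzT (s + 3 ^ J * d) = y := by
        generalize s + 3 ^ J * d = z at hz
        unfold collatzT
        split_ifs <;> omega
      rw [← hzy, reachesOne_collatzT_iff]
      refine hs _ (by omega) ?_ ?_
      · refine h3.mul_right_injective ?_
        have := congrArg (Int.cast : ℤ → ZMod q) hz
        push_cast at this ⊢
        simp only [hrr', ← this, hyr]
      · exact (Int.modEq_iff_dvd).2 ⟨-d, by ring⟩) r
  obtain ⟨y, hy, hyr, hys, hym⟩ := hr J s
  exact hym.1 (hJs y hy hyr hys)
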